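/- arXiv:1704.06905 — 3 statements merged into one kernel-verified Lean document; each statement's English description precedes it below -/
import Mathlib

section
/- Let N be a finite type of nodes and ℓ : N → N → Prop a relation of live edges. Define the spread f(S) of a finset S of nodes as the cardinality of the reachable set ρ(S) = {w : N | ∃ v ∈ S, Relation.ReflTransGen ℓ v w}. Then f is submodular: for all finsets A ⊆ B of N and every v : N, f(A ∪ {v}) − f(A) ≥ f(B ∪ {v}) − f(B), the differences being taken in ℤ. -/
/-- The set of nodes reachable from the seed finset `S` via live edges `ℓ`. -/
def reachSet {N : Type*} (ℓ : N → N → Prop) (S : Finset N) : Set N :=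
  {w : N | ∃ v ∈ S, Relation.ReflTransGen ℓ v w}

/-- The spread of a seed finset `S`: the cardinality of its reachable set. -/
noncomputable def spread {N : Type*} (ℓ : N → N → Prop) (S : Finset N) : ℕ :=
  (reachSet ℓ S).ncard

theorem reachSet_union {N : Type*} [DecidableEq N] (ℓ : N → N → Prop) (S T : Finset N) :
    reachSet ℓ (S ∪ T) = reachSet ℓ S ∪ reachSet ℓ T := by
  ext w
  simp only [reachSet, Finset.mem_union, Set.mem_ofPred_eq, Set.mem_union, or_and_right, exists_or]

theorem reachSet_mono {N : Type*} (ℓ : N → N → Prop) : Monotone (reachSet ℓ) :=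
  fun _ _ hST _ ⟨v, hv, hvw⟩ => ⟨v, hST hv, hvw⟩

/-- The marginal gain of adding `T` to `S` counts the nodes reachable from `T` but not `S`. -/
theorem spread_union {N : Type*} [Finite N] [DecidableEq N] (ℓ : N → N → Prop)
    (S T : Finset N) :
    spread ℓ (S ∪ T) = (reachSet ℓ T \ reachSet ℓ S).ncard + spread ℓ S := by
  rw [spread, spread, reachSet_union, Set.union_comm, Set.ncard_sdiff_add_ncard]

/-- Lemma 3: the spread `f(S) = |ρ(S)|` is submodular: for finsets
`A ⊆ B` and any node `v`, `f(A ∪ {v}) − f(A) ≥ f(B ∪ {v}) − f(B)` in `ℤ`. -/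
theorem spread_submodular {N : Type*} [Fintype N] [DecidableEq N]
    (ℓ : N → N → Prop) (A B : Finset N) (hAB : A ⊆ B) (v : N) :
    (spread ℓ (A ∪ {v}) : ℤ) - (spread ℓ A : ℤ) ≥
      (spread ℓ (B ∪ {v}) : ℤ) - (spread ℓ B : ℤ) := by
  have h : (reachSet ℓ {v} \ reachSet ℓ B).ncard ≤ (reachSet ℓ {v} \ reachSet ℓ A).ncard :=
    Set.ncard_le_ncard (Set.sdiff_subset_sdiff_right (reachSet_mono ℓ hAB))
  rw [spread_union ℓ A, spread_union ℓ B]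
  omega
end

section
/- Let N be a finite type of nodes, Φ a finite index type of realizations, p : Φ → ℝ with p(φ) ≥ 0 for all φ, and for each φ a relation ℓ_φ : N → N → Prop. Define the expected spread F(S) = ∑_{φ} p(φ) · |ρ_φ(S)|, where ρ_φ(S) = {w | ∃ v ∈ S, Relation.ReflTransGen (ℓ_φ) v w}. Then F is monotone (A ⊆ B implies F(A) ≤ F(B)) and submodular (for all finsets A ⊆ B of N and every x : N, F(A ∪ {x}) − F(A) ≥ F(B ∪ {x}) − F(B)). -/
/-- The expected spread `F(S) = ∑_φ p(φ) · |ρ_φ(S)|`. -/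
noncomputable def expectedSpread {N Φ : Type*} [Fintype Φ] (p : Φ → ℝ)
    (ℓ : Φ → N → N → Prop) (S : Finset N) : ℝ :=
  ∑ φ : Φ, p φ * ((reachSet (ℓ φ) S).ncard : ℝ)

theorem reachSet_mono_s7 {N : Type*} (ℓ : N → N → Prop) {A B : Finset N} (h : A ⊆ B) :
    reachSet ℓ A ⊆ reachSet ℓ B :=
  fun _ ⟨v, hv, hvw⟩ => ⟨v, h hv, hvw⟩

theorem reachSet_insert {N : Type*} [DecidableEq N] (ℓ : N → N → Prop) (x : N) (S : Finset N) :
    reachSet ℓ (insert x S) = {w | Relation.ReflTransGen ℓ x w} ∪ reachSet ℓ S := by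
  ext w
  simp [reachSet]

theorem ncard_reachSet_insert {N : Type*} [Finite N] [DecidableEq N] (ℓ : N → N → Prop)
    (x : N) (S : Finset N) :
    (reachSet ℓ (insert x S)).ncard =
      ({w | Relation.ReflTransGen ℓ x w} \ reachSet ℓ S).ncard + (reachSet ℓ S).ncard := by
  rw [reachSet_insert, Set.ncard_sdiff_add_ncard]

/-- key step of Lemma 7: the expected spread is monotone and
submodular. -/
theorem expectedSpread_monotone_submodular {N Φ : Type*} [Fintype N]
    [DecidableEq N] [Fintype Φ] (p : Φ → ℝ) (hp : ∀ φ, 0 ≤ p φ)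
    (ℓ : Φ → N → N → Prop) :
    (∀ A B : Finset N, A ⊆ B →
        expectedSpread p ℓ A ≤ expectedSpread p ℓ B) ∧
      (∀ A B : Finset N, A ⊆ B → ∀ x : N,
        expectedSpread p ℓ (insert x A) - expectedSpread p ℓ A ≥
          expectedSpread p ℓ (insert x B) - expectedSpread p ℓ B) := by
  refine ⟨fun A B h => ?_, fun A B h x => ?_⟩
  · exact Finset.sum_le_sum fun φ _ => mul_le_mul_of_nonneg_left
      (Nat.cast_le.2 (Set.ncard_le_ncard (reachSet_mono_s7 (ℓ φ) h))) (hp φ)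
  · simp only [expectedSpread, ← Finset.sum_sub_distrib, ← mul_sub, ncard_reachSet_insert,
      Nat.cast_add, add_sub_cancel_right]
    exact Finset.sum_le_sum fun φ _ => mul_le_mul_of_nonneg_left
      (Nat.cast_le.2 (Set.ncard_le_ncard (Set.sdiff_subset_sdiff_right (reachSet_mono_s7 (ℓ φ) h))))
      (hp φ)
end

section
/- Let α be a finite type and F : Finset α → ℝ a function with F(∅) = 0 that is monotone (A ⊆ B implies F(A) ≤ F(B)) and submodular (for all finsets A ⊆ B and every x, F(insert x A) − F(A) ≥ F(insert x B) − F(B)). Let k : ℕ and let G₀ = ∅, G₁, …, G_k be a greedy chain: for each i < k, G_{i+1} = insert x_i G_i where x_i ∉ G_i satisfies F(insert x_i G_i) ≥ F(insert x G_i) for every x : α. Then for every finset S with S.card ≤ k, F(G_k) ≥ (1 − 1/e) · F(S), where e = Real.exp 1. -/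
/-- For a submodular `F`, the gain from adding `S` to `A` is at most the sum of the gains from
adding the elements of `S` one at a time. -/
theorem union_sub_le_sum_insert_sub {α : Type*} [DecidableEq α] {F : Finset α → ℝ}
    (hsubmod : ∀ A B : Finset α, A ⊆ B → ∀ x : α,
      F (insert x A) - F A ≥ F (insert x B) - F B)
    (A S : Finset α) :
    F (A ∪ S) - F A ≤ ∑ y ∈ S, (F (insert y A) - F A) := by
  induction S using Finset.induction_on with
  | empty => simp
  | insert a S ha ih =>
    rw [Finset.sum_insert ha, Finset.union_insert]
    linarith [hsubmod A (A ∪ S) Finset.subset_union_left a]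

/-- For a monotone submodular `F` and a set `S` of at most `k` elements, if no single insertion
into `A` reaches a value above `m`, then `k` times the gain `m - F A` covers `F S - F A`. -/
theorem sub_le_card_mul_of_insert_le {α : Type*} [DecidableEq α] {F : Finset α → ℝ}
    (hmono : ∀ A B : Finset α, A ⊆ B → F A ≤ F B)
    (hsubmod : ∀ A B : Finset α, A ⊆ B → ∀ x : α,
      F (insert x A) - F A ≥ F (insert x B) - F B)
    {A S : Finset α} {k : ℕ} {m : ℝ} (hS : S.card ≤ k)
    (hAm : F A ≤ m) (hm : ∀ y : α, F (insert y A) ≤ m) :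
    F S - F A ≤ k * (m - F A) := by
  calc F S - F A ≤ F (A ∪ S) - F A := by linarith [hmono S (A ∪ S) Finset.subset_union_right]
    _ ≤ ∑ y ∈ S, (F (insert y A) - F A) := union_sub_le_sum_insert_sub hsubmod A S
    _ ≤ S.card * (m - F A) := by
      rw [← nsmul_eq_mul]
      exact Finset.sum_le_card_nsmul _ _ _ fun y _ => by linarith [hm y]
    _ ≤ k * (m - F A) := by
      have : (S.card : ℝ) ≤ k := by exact_mod_cast hS
      have : 0 ≤ m - F A := by linarith
      gcongr


/-- Nemhauser–Wolsey–Fisher: greedy maximization of a monotone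
submodular set function `F` with `F(∅) = 0` under a cardinality constraint `k`
achieves a `(1 − 1/e)`-approximation of any feasible set. -/
theorem greedy_submodular_approx {α : Type*} [Fintype α] [DecidableEq α]
    (F : Finset α → ℝ)
    (hF0 : F ∅ = 0)
    (hmono : ∀ A B : Finset α, A ⊆ B → F A ≤ F B)
    (hsubmod : ∀ A B : Finset α, A ⊆ B → ∀ x : α,
      F (insert x A) - F A ≥ F (insert x B) - F B)
    (k : ℕ) (G : ℕ → Finset α) (x : ℕ → α)
    (hG0 : G 0 = ∅)
    (hstep : ∀ i < k, x i ∉ G i ∧ G (i + 1) = insert (x i) (G i) ∧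
      ∀ y : α, F (insert (x i) (G i)) ≥ F (insert y (G i))) :
    ∀ S : Finset α, S.card ≤ k →
      F (G k) ≥ (1 - 1 / Real.exp 1) * F S := by
  intro S hS
  have hFS : 0 ≤ F S := hF0 ▸ hmono ∅ S (Finset.empty_subset S)
  rcases Nat.eq_zero_or_pos k with rfl | hk
  · have hS' : S = ∅ := by simpa using hS
    simp [hS', hG0, hF0]
  have hk1 : (1 : ℝ) ≤ k := by exact_mod_cast hk
  have hk0 : (0 : ℝ) < k := by linarith
  have hr : 0 ≤ 1 - 1 / (k : ℝ) := by
    rw [sub_nonneg, div_le_one hk0]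
    exact hk1
  have gap : ∀ i ≤ k, F S - F (G i) ≤ (1 - 1 / (k : ℝ)) ^ i * F S := by
    intro i
    induction i with
    | zero => simp [hG0, hF0]
    | succ i ih =>
      intro hi
      obtain ⟨-, hG, hmax⟩ := hstep i hi
      have hgain := sub_le_card_mul_of_insert_le hmono hsubmod hS
        (hmono _ _ (Finset.subset_insert (x i) (G i))) hmax
      rw [← div_le_iff₀' hk0] at hgain
      calc F S - F (G (i + 1)) ≤ (1 - 1 / (k : ℝ)) * (F S - F (G i)) := by
            rw [hG, one_sub_mul, one_div_mul_eq_div]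
            linarith
        _ ≤ (1 - 1 / (k : ℝ)) * ((1 - 1 / (k : ℝ)) ^ i * F S) := by
            gcongr
            exact ih (by omega)
        _ = (1 - 1 / (k : ℝ)) ^ (i + 1) * F S := by ring
  have hexp : (1 - 1 / (k : ℝ)) ^ k ≤ 1 / Real.exp 1 := by
    rw [one_div (Real.exp 1), ← Real.exp_neg]
    exact Real.one_sub_div_pow_le_exp_neg hk1
  nlinarith [gap k le_rfl, mul_le_mul_of_nonneg_right hexp hFS]
end
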